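/- Suppose the limit L = lim_{n→∞} (M_n)^{1/n} exists and satisfies L ≤ √12.901. Then limsup_{n→∞} (M^{Irr}_n)^{1/n} ≤ 3.33341. -/

import Mathlib

open Filter

/-- `x` lies strictly between `p` and `q`. -/
def StrictlyBetween (p q x : ℕ) : Prop := min p q < x ∧ x < max p q

/-- Two arcs `{p, q}` and `{r, s}` cross if exactly one of `r`, `s` lies strictly
between `p` and `q`. -/
def ArcsCross (p q r s : ℕ) : Prop :=
  Xor' (StrictlyBetween p q r) (StrictlyBetween p q s)

/-- `a` (with one-based indexing, only the values `a 1, …, a n` being relevant)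
is an open meandric permutation of order `n`: it is a permutation of `{1, …, n}`
with `a i ≡ i (mod 2)`, whose upper arcs (pairs `{a i, a (i+1)}` for odd `i < n`)
are pairwise noncrossing, whose lower arcs (pairs `{a i, a (i+1)}` for even
`1 ≤ i < n`) are pairwise noncrossing, such that no lower arc strictly encloses
`a 1`, and no lower arc (if `n` is even) resp. upper arc (if `n` is odd)
strictly encloses `a n`. -/
def IsOpenMeandricPerm (n : ℕ) (a : ℕ → ℕ) : Prop :=
  1 ≤ n ∧
  (∀ i, 1 ≤ i → i ≤ n → 1 ≤ a i ∧ a i ≤ n) ∧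
  (∀ i j, 1 ≤ i → i ≤ n → 1 ≤ j → j ≤ n → a i = a j → i = j) ∧
  (∀ i, 1 ≤ i → i ≤ n → a i % 2 = i % 2) ∧
  (∀ i j, Odd i → i < n → Odd j → j < n →
      ¬ ArcsCross (a i) (a (i + 1)) (a j) (a (j + 1))) ∧
  (∀ i j, Even i → 1 ≤ i → i < n → Even j → 1 ≤ j → j < n →
      ¬ ArcsCross (a i) (a (i + 1)) (a j) (a (j + 1))) ∧
  (∀ i, Even i → 1 ≤ i → i < n → ¬ StrictlyBetween (a i) (a (i + 1)) (a 1)) ∧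
  (if Even n
    then ∀ i, Even i → 1 ≤ i → i < n → ¬ StrictlyBetween (a i) (a (i + 1)) (a n)
    else ∀ i, Odd i → i < n → ¬ StrictlyBetween (a i) (a (i + 1)) (a n))

/-- An open meandric permutation of order `n` is irreducible if there are no
indices `1 ≤ k₁ < k₂ ≤ n` with `2 < k₂ - k₁ ≤ n - 2` such that the values
`a k₁, …, a k₂` form an interval of integers, i.e. their max minus their min
equals `k₂ - k₁`. -/
def IsIrreducibleMeander (n : ℕ) (a : ℕ → ℕ) : Prop :=
  ¬ ∃ k₁ k₂ : ℕ, ∃ h : k₁ < k₂, 1 ≤ k₁ ∧ k₂ ≤ n ∧ 2 < k₂ - k₁ ∧ k₂ - k₁ ≤ n - 2 ∧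
    (Finset.Icc k₁ k₂).sup' (Finset.nonempty_Icc.mpr h.le) a -
      (Finset.Icc k₁ k₂).inf' (Finset.nonempty_Icc.mpr h.le) a = k₂ - k₁

/-- An open meandric permutation of order `n` is prime if `a 1 ≠ 1` and no proper
initial segment `a 1, …, a j` (`2 ≤ j < n`) is a permutation of `{1, …, j}`. -/
def IsPrimeMeander (n : ℕ) (a : ℕ → ℕ) : Prop :=
  a 1 ≠ 1 ∧ ¬ ∃ j, 2 ≤ j ∧ j < n ∧ (Finset.Icc 1 j).image a = Finset.Icc 1 j

/-- `a` (with one-based indexing) is a closed meandric permutation of order `n`: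
a permutation of `{1, …, 2n}` with `a 1 = 1`, `a i ≡ i (mod 2)`, pairwise
noncrossing upper arcs `{a i, a (i+1)}` (odd `i < 2n`) and pairwise noncrossing
lower arcs, the latter being the `{a i, a (i+1)}` for even `1 ≤ i < 2n` together
with the wrap-around arc `{a (2n), a 1}`. -/
def IsClosedMeandricPerm (n : ℕ) (a : ℕ → ℕ) : Prop :=
  1 ≤ n ∧ a 1 = 1 ∧
  (∀ i, 1 ≤ i → i ≤ 2 * n → 1 ≤ a i ∧ a i ≤ 2 * n) ∧
  (∀ i j, 1 ≤ i → i ≤ 2 * n → 1 ≤ j → j ≤ 2 * n → a i = a j → i = j) ∧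
  (∀ i, 1 ≤ i → i ≤ 2 * n → a i % 2 = i % 2) ∧
  (∀ i j, Odd i → i < 2 * n → Odd j → j < 2 * n →
      ¬ ArcsCross (a i) (a (i + 1)) (a j) (a (j + 1))) ∧
  (∀ i j, Even i → 1 ≤ i → i < 2 * n → Even j → 1 ≤ j → j < 2 * n →
      ¬ ArcsCross (a i) (a (i + 1)) (a j) (a (j + 1))) ∧
  (∀ i, Even i → 1 ≤ i → i < 2 * n →
      ¬ ArcsCross (a i) (a (i + 1)) (a (2 * n)) (a 1) ∧
      ¬ ArcsCross (a (2 * n)) (a 1) (a i) (a (i + 1)))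

/-- `M n`: the number of open meandric permutations of order `n` (each counted
once via the normalization `a i = 0` outside `{1, …, n}`). -/
noncomputable def openMeanderCount (n : ℕ) : ℕ :=
  Set.ncard {a : ℕ → ℕ | IsOpenMeandricPerm n a ∧ ∀ i, i < 1 ∨ n < i → a i = 0}

/-- `M^{Irr} n`: the number of irreducible open meandric permutations of order `n`. -/
noncomputable def irrMeanderCount (n : ℕ) : ℕ :=
  Set.ncard {a : ℕ → ℕ | IsOpenMeandricPerm n a ∧ IsIrreducibleMeander n a ∧
    ∀ i, i < 1 ∨ n < i → a i = 0}

/-- `M^{(P)} n`: the number of prime open meandric permutations of order `n`. -/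
noncomputable def primeMeanderCount (n : ℕ) : ℕ :=
  Set.ncard {a : ℕ → ℕ | IsOpenMeandricPerm n a ∧ IsPrimeMeander n a ∧
    ∀ i, i < 1 ∨ n < i → a i = 0}

/-- `M̄ n`: the number of closed meandric permutations of order `n`. -/
noncomputable def closedMeanderCount (n : ℕ) : ℕ :=
  Set.ncard {a : ℕ → ℕ | IsClosedMeandricPerm n a ∧ ∀ i, i < 1 ∨ 2 * n < i → a i = 0}

/-- `ConsecutiveAt n a r x y`: the values `x` and `y` are consecutive along `a`, the smaller of the two
positions having remainder `r` modulo `2`; `r = 1` describes upper arcs and `r = 0` lower arcs. -/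
def ConsecutiveAt (n : ℕ) (a : ℕ → ℕ) (r x y : ℕ) : Prop :=
  ∃ i, 1 ≤ i ∧ i < n ∧ i % 2 = r ∧ ((a i = x ∧ a (i + 1) = y) ∨ (a i = y ∧ a (i + 1) = x))

/-- A relation describing pairwise disjoint noncrossing arcs, none of which encloses a point that
lies on no arc. -/
structure IsArcSystem (A : ℕ → ℕ → Prop) : Prop where
  lt : ∀ {p q}, A p q → p < q
  unique : ∀ {p q p' q'}, A p q → A p' q' → p = p' ∨ p = q' ∨ q = p' ∨ q = q' → p = p' ∧ q = q'
  inner : ∀ {p q v}, A p q → p < v → v < q → ∃ w, p < w ∧ w < q ∧ (A v w ∨ A w v)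

namespace IsArcSystem

variable {A B : ℕ → ℕ → Prop}

/-- An arc system is determined by the left ends of its arcs. -/
theorem iff_of_openers (hA : IsArcSystem A) (hB : IsArcSystem B)
    (h : ∀ v, (∃ q, A v q) ↔ ∃ q, B v q) : ∀ p q, A p q ↔ B p q := by
  have key : ∀ d {A B : ℕ → ℕ → Prop}, IsArcSystem A → IsArcSystem B →
      (∀ v, (∃ q, A v q) ↔ ∃ q, B v q) → (∀ p q, q - p < d → (A p q ↔ B p q)) →
      ∀ p q, q - p = d → A p q → B p q := by
    intro d A B hA hB h ih p q hd hpq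
    obtain ⟨q', hq'⟩ := (h p).1 ⟨q, hpq⟩
    have h1 := hA.lt hpq
    have h2 := hB.lt hq'
    rcases lt_trichotomy q' q with hlt | rfl | hgt
    · have h3 := (ih p q' (by omega)).2 hq'
      have h4 := hA.unique hpq h3 (Or.inl rfl)
      omega
    · exact hq'
    · obtain ⟨w, hw1, hw2, hw | hw⟩ := hB.inner hq' h1 hgt
      · obtain ⟨z, hz⟩ := (h q).2 ⟨w, hw⟩
        have h4 := hA.unique hpq hz (by simp)
        omega
      · have h5 := hB.lt hw
        have h3 := (ih w q (by omega)).2 hw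
        have h4 := hA.unique hpq h3 (by simp)
        omega
  have main : ∀ d p q, q - p = d → (A p q ↔ B p q) := by
    intro d
    induction d using Nat.strong_induction_on with
    | _ d ih =>
      have ih' : ∀ p q, q - p < d → (A p q ↔ B p q) := fun p q hlt => ih _ hlt p q rfl
      exact fun p q hd => ⟨key d hA hB h ih' p q hd,
        key d hB hA (fun v => (h v).symm) (fun p q hlt => (ih' p q hlt).symm) p q hd⟩
  exact fun p q => main _ p q rfl

theorem adjacent (hA : IsArcSystem A) {v : ℕ} (h0 : ∃ q, A v q) (h1 : ¬ ∃ q, A (v + 1) q) :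
    A v (v + 1) := by
  obtain ⟨q, hq⟩ := h0
  have hlt := hA.lt hq
  rcases (show q = v + 1 ∨ v + 1 < q by omega) with rfl | hgt
  · exact hq
  · obtain ⟨w, hw1, hw2, hw | hw⟩ := hA.inner hq (Nat.lt_succ_self v) hgt
    · exact (h1 ⟨w, hw⟩).elim
    · have := hA.lt hw
      omega

theorem enclosing (hA : IsArcSystem A) {v : ℕ} (h0 : ∃ q, A v q) (h1 : ∃ q, A (v + 1) q)
    (h2 : ¬ ∃ q, A (v + 2) q) (h3 : ¬ ∃ q, A (v + 3) q) : A v (v + 3) := by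
  have hin : A (v + 1) (v + 2) := hA.adjacent h1 h2
  obtain ⟨q, hq⟩ := h0
  have hlt := hA.lt hq
  have hne1 : q ≠ v + 1 := fun h => by
    have := hA.unique hq hin (by omega)
    omega
  have hne2 : q ≠ v + 2 := fun h => by
    have := hA.unique hq hin (by omega)
    omega
  rcases (show q = v + 3 ∨ v + 3 < q by omega) with rfl | hgt
  · exact hq
  · obtain ⟨w, hw1, hw2, hw | hw⟩ := hA.inner hq (show v < v + 3 by omega) hgt
    · exact (h3 ⟨w, hw⟩).elim
    · have := hA.lt hw
      have := hA.unique hw hin (by omega)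
      omega

end IsArcSystem

/-- The arcs of one side, written with the smaller end first. -/
def SideArc (n : ℕ) (a : ℕ → ℕ) (r p q : ℕ) : Prop := p < q ∧ ConsecutiveAt n a r p q

theorem ConsecutiveAt.symm {n : ℕ} {a : ℕ → ℕ} {r x y : ℕ} (h : ConsecutiveAt n a r x y) :
    ConsecutiveAt n a r y x := by
  obtain ⟨i, h1, h2, h3, h4⟩ := h
  exact ⟨i, h1, h2, h3, h4.symm⟩

namespace IsOpenMeandricPerm

variable {n : ℕ} {a b : ℕ → ℕ}

theorem surjective (h : IsOpenMeandricPerm n a) {v : ℕ} (h1 : 1 ≤ v) (h2 : v ≤ n) :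
    ∃ i, 1 ≤ i ∧ i ≤ n ∧ a i = v := by
  obtain ⟨-, hr, hi, -⟩ := h
  have hs : Set.SurjOn a (Finset.Icc 1 n : Finset ℕ) (Finset.Icc 1 n : Finset ℕ) := by
    apply Finset.surjOn_of_injOn_of_card_le
    · intro i hi'
      simp only [Finset.coe_Icc, Set.mem_Icc] at hi' ⊢
      exact hr i hi'.1 hi'.2
    · intro i hi' j hj' hij
      simp only [Finset.coe_Icc, Set.mem_Icc] at hi' hj'
      exact hi i j hi'.1 hi'.2 hj'.1 hj'.2 hij
    · exact le_rfl
  obtain ⟨i, hi', rfl⟩ := hs (show v ∈ ((Finset.Icc 1 n : Finset ℕ) : Set ℕ) by simp [h1, h2])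
  simp only [Finset.coe_Icc, Set.mem_Icc] at hi'
  exact ⟨i, hi'.1, hi'.2, rfl⟩

theorem not_cross (h : IsOpenMeandricPerm n a) {i j : ℕ} (hi : 1 ≤ i) (hin : i < n)
    (hj : 1 ≤ j) (hjn : j < n) (hij : i % 2 = j % 2) :
    ¬ ArcsCross (a i) (a (i + 1)) (a j) (a (j + 1)) := by
  obtain ⟨-, -, -, -, hU, hL, -⟩ := h
  rcases Nat.even_or_odd i with he | ho
  · exact hL i j he hi hin (by rw [Nat.even_iff] at he ⊢; omega) hj hjn
  · exact hU i j ho hin (by rw [Nat.odd_iff] at ho ⊢; omega) hjn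

theorem isArcSystem (h : IsOpenMeandricPerm n a) (r : ℕ) : IsArcSystem (SideArc n a r) := by
  have hc := @not_cross n a h
  have hs := @surjective n a h
  obtain ⟨hn, hr, hi, hp, -, -, hR1, hR2⟩ := h
  refine ⟨fun h => h.1, ?_, ?_⟩
  · rintro p q p' q' ⟨hpq, i, hi1, hin, hir, hia⟩ ⟨hpq', j, hj1, hjn, hjr, hja⟩ hor
    have e1 := hi i j hi1 hin.le hj1 hjn.le
    have e2 := hi i (j + 1) hi1 hin.le (by omega) (by omega)
    have e3 := hi (i + 1) j (by omega) (by omega) hj1 hjn.le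
    have e4 := hi (i + 1) (j + 1) (by omega) (by omega) (by omega) (by omega)
    have hij : i = j := by omega
    subst hij
    omega
  · rintro p q v ⟨hpq, i, hi1, hin, hir, hia⟩ hpv hvq
    have hpb : ∀ w, StrictlyBetween (a i) (a (i + 1)) w ↔ p < w ∧ w < q := by
      intro w
      unfold StrictlyBetween
      omega
    have b1 := hr i hi1 hin.le
    have b2 := hr (i + 1) (by omega) (by omega)
    obtain ⟨j, hj1, hjn, rfl⟩ := hs (v := v) (by omega) (by omega)
    have fin : ∀ k, 1 ≤ k → k < n → k % 2 = r → j = k ∨ j = k + 1 →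
        ∃ w, p < w ∧ w < q ∧ (SideArc n a r (a j) w ∨ SideArc n a r w (a j)) := by
      intro k hk1 hkn hkr hjk
      have hx := hc hi1 hin hk1 hkn (by omega)
      have hne := hi k (k + 1) hk1 hkn.le (by omega) (by omega)
      unfold ArcsCross at hx
      replace hx := not_xor _ _ |>.1 hx
      rw [hpb, hpb] at hx
      rcases hjk with rfl | rfl
      · refine ⟨a (j + 1), (hx.1 ⟨hpv, hvq⟩).1, (hx.1 ⟨hpv, hvq⟩).2, ?_⟩
        rcases lt_trichotomy (a j) (a (j + 1)) with hlt | heq | hgt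
        · exact Or.inl ⟨hlt, j, hk1, hkn, hkr, Or.inl ⟨rfl, rfl⟩⟩
        · have := hne heq
          omega
        · exact Or.inr ⟨hgt, j, hk1, hkn, hkr, Or.inr ⟨rfl, rfl⟩⟩
      · refine ⟨a k, (hx.2 ⟨hpv, hvq⟩).1, (hx.2 ⟨hpv, hvq⟩).2, ?_⟩
        rcases lt_trichotomy (a k) (a (k + 1)) with hlt | heq | hgt
        · exact Or.inr ⟨hlt, k, hk1, hkn, hkr, Or.inl ⟨rfl, rfl⟩⟩
        · have := hne heq
          omega
        · exact Or.inl ⟨hgt, k, hk1, hkn, hkr, Or.inr ⟨rfl, rfl⟩⟩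
    by_cases hjr : j % 2 = r
    · rcases hjn.lt_or_eq with hlt | rfl
      · exact fin j hj1 hlt hjr (Or.inl rfl)
      · exfalso
        split_ifs at hR2 with he
        · exact hR2 i (by rw [Nat.even_iff] at he ⊢; omega) hi1 hin ((hpb _).2 ⟨hpv, hvq⟩)
        · rw [Nat.not_even_iff] at he
          exact hR2 i (by rw [Nat.odd_iff]; omega) hin ((hpb _).2 ⟨hpv, hvq⟩)
    · rcases hj1.lt_or_eq with hlt | rfl
      · exact fin (j - 1) (by omega) (by omega) (by omega) (by omega)
      · exact (hR1 i (by rw [Nat.even_iff]; omega) hi1 hin ((hpb _).2 ⟨hpv, hvq⟩)).elim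

theorem joined_succ (h : IsOpenMeandricPerm n a) {i y r : ℕ} (h1 : 1 ≤ i) (h2 : i < n)
    (hr : i % 2 = r) (hj : ConsecutiveAt n a r (a i) y) : y = a (i + 1) := by
  obtain ⟨-, -, hi, -⟩ := h
  obtain ⟨j, hj1, hjn, hjr, ⟨e1, e2⟩ | ⟨e1, e2⟩⟩ := hj
  · have := hi j i hj1 hjn.le h1 h2.le e1
    rw [← e2, this]
  · have := hi (j + 1) i (by omega) (by omega) h1 h2.le e2
    omega

theorem eq_first_iff (h : IsOpenMeandricPerm n a) {v : ℕ} :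
    v = a 1 ↔ 1 ≤ v ∧ v ≤ n ∧ v % 2 = 1 ∧ ¬ ∃ y, ConsecutiveAt n a 0 v y := by
  have hs := @surjective n a h
  obtain ⟨hn, hr, hi, hp, -⟩ := h
  constructor
  · rintro rfl
    refine ⟨(hr 1 le_rfl hn).1, (hr 1 le_rfl hn).2, hp 1 le_rfl hn, ?_⟩
    rintro ⟨y, j, hj1, hjn, hjr, ⟨e1, e2⟩ | ⟨e1, e2⟩⟩
    · have := hi j 1 hj1 hjn.le le_rfl hn e1
      omega
    · have := hi (j + 1) 1 (by omega) (by omega) le_rfl hn e2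
      omega
  · rintro ⟨hv1, hvn, hv2, hv⟩
    obtain ⟨i, hi1, hin, rfl⟩ := hs hv1 hvn
    have hpi := hp i hi1 hin
    rcases hi1.lt_or_eq with hlt | rfl
    · refine (hv ⟨a (i - 1), i - 1, by omega, by omega, by omega, Or.inr ⟨rfl, ?_⟩⟩).elim
      congr 1
      omega
    · rfl

theorem joined_iff (h : IsOpenMeandricPerm n a) {r x y : ℕ} :
    ConsecutiveAt n a r x y ↔ SideArc n a r x y ∨ SideArc n a r y x := by
  constructor
  · intro hj
    rcases lt_trichotomy x y with hlt | rfl | hgt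
    · exact Or.inl ⟨hlt, hj⟩
    · obtain ⟨i, h1, h2, -, h4⟩ := hj
      have := h.2.2.1 i (i + 1) h1 h2.le (by omega) (by omega) (by omega)
      omega
    · exact Or.inr ⟨hgt, hj.symm⟩
  · rintro (hj | hj)
    · exact hj.2
    · exact hj.2.symm

/-- An open meandric permutation is determined by the left ends of its upper and lower arcs. -/
theorem eq_of_openers (ha : IsOpenMeandricPerm n a) (hb : IsOpenMeandricPerm n b)
    (h : ∀ r < 2, ∀ v, (∃ q, SideArc n a r v q) ↔ ∃ q, SideArc n b r v q) :
    ∀ i, 1 ≤ i → i ≤ n → a i = b i := by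
  have hJ : ∀ r < 2, ∀ x y, ConsecutiveAt n a r x y ↔ ConsecutiveAt n b r x y := by
    intro r hr x y
    have := (ha.isArcSystem r).iff_of_openers (hb.isArcSystem r) (h r hr)
    rw [ha.joined_iff, hb.joined_iff, this, this]
  intro i hi
  induction i, hi using Nat.le_induction with
  | base =>
    intro _
    rw [hb.eq_first_iff]
    have := (ha.eq_first_iff (v := a 1)).1 rfl
    simpa only [hJ 0 (by norm_num)] using this
  | succ i hi ih =>
    intro hin
    have hlt : i % 2 < 2 := Nat.mod_lt _ (by norm_num)
    have hj : ConsecutiveAt n a (i % 2) (a i) (a (i + 1)) :=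
      ⟨i, hi, by omega, rfl, Or.inl ⟨rfl, rfl⟩⟩
    rw [hJ _ hlt, ih (by omega)] at hj
    exact hb.joined_succ hi (by omega) rfl hj

theorem not_joined_both (h : IsOpenMeandricPerm n a) {r s x y : ℕ} (hrs : r ≠ s)
    (h1 : ConsecutiveAt n a r x y) (h2 : ConsecutiveAt n a s x y) : False := by
  obtain ⟨-, -, hi, -⟩ := h
  obtain ⟨i, hi1, hin, hir, hia⟩ := h1
  obtain ⟨j, hj1, hjn, hjr, hja⟩ := h2
  have e1 := hi i j hi1 hin.le hj1 hjn.le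
  have e2 := hi i (j + 1) hi1 hin.le (by omega) (by omega)
  have e3 := hi (i + 1) j (by omega) (by omega) hj1 hjn.le
  have e4 := hi (i + 1) (j + 1) (by omega) (by omega) (by omega) (by omega)
  omega

theorem exists_chain_three (h : IsOpenMeandricPerm n a) {r s x y z : ℕ} (hrs : r ≠ s)
    (h1 : ConsecutiveAt n a r x y) (h2 : ConsecutiveAt n a s y z) :
    ∃ k, 1 ≤ k ∧ k + 2 ≤ n ∧ ((k % 2 = r ∧ a k = x ∧ a (k + 1) = y ∧ a (k + 2) = z) ∨
      (k % 2 = s ∧ a k = z ∧ a (k + 1) = y ∧ a (k + 2) = x)) := by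
  obtain ⟨-, -, hi, -⟩ := h
  obtain ⟨i, hi1, hin, hir, hia⟩ := h1
  obtain ⟨j, hj1, hjn, hjs, hja⟩ := h2
  have hne : i ≠ j := by
    rintro rfl
    exact hrs (hir.symm.trans hjs)
  rcases hia with ⟨a1, a2⟩ | ⟨a1, a2⟩ <;> rcases hja with ⟨b1, b2⟩ | ⟨b1, b2⟩
  · obtain rfl := hi (i + 1) j (by omega) (by omega) hj1 hjn.le (a2.trans b1.symm)
    exact ⟨i, hi1, by omega, Or.inl ⟨hir, a1, a2, b2⟩⟩
  · have := hi (i + 1) (j + 1) (by omega) (by omega) (by omega) (by omega) (a2.trans b2.symm)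
    omega
  · exact (hne (hi i j hi1 hin.le hj1 hjn.le (a1.trans b1.symm))).elim
  · obtain rfl := hi i (j + 1) hi1 hin.le (by omega) (by omega) (a1.trans b2.symm)
    exact ⟨j, hj1, by omega, Or.inr ⟨hjs, b1, b2, a2⟩⟩

theorem exists_chain_four (h : IsOpenMeandricPerm n a) {r s x y z t : ℕ} (hrs : r ≠ s)
    (h1 : ConsecutiveAt n a r x y) (h2 : ConsecutiveAt n a s y z) (h3 : ConsecutiveAt n a r z t) :
    ∃ k, 1 ≤ k ∧ k + 3 ≤ n ∧
      ((a k = x ∧ a (k + 1) = y ∧ a (k + 2) = z ∧ a (k + 3) = t) ∨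
       (a k = t ∧ a (k + 1) = z ∧ a (k + 2) = y ∧ a (k + 3) = x)) := by
  obtain ⟨k, hk1, hkn, ⟨hkr, e0, e1, e2⟩ | ⟨hks, e0, e1, e2⟩⟩ := h.exists_chain_three hrs h1 h2
  · obtain ⟨l, hl1, hln, ⟨hlr, f0, f1, f2⟩ | ⟨hlr, f0, f1, f2⟩⟩ :=
      h.exists_chain_three hrs.symm h2 h3
    · obtain rfl := h.2.2.1 l (k + 1) hl1 (by omega) (by omega) (by omega) (f0.trans e1.symm)
      exact ⟨k, hk1, by omega, Or.inl ⟨e0, e1, e2, f2⟩⟩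
    · have := h.2.2.1 (l + 1) (k + 2) (by omega) (by omega) (by omega) (by omega)
        (f1.trans e2.symm)
      have := h.2.2.1 (l + 2) (k + 1) (by omega) (by omega) (by omega) (by omega)
        (f2.trans e1.symm)
      omega
  · obtain ⟨l, hl1, hln, ⟨hlr, f0, f1, f2⟩ | ⟨hlr, f0, f1, f2⟩⟩ :=
      h.exists_chain_three hrs.symm h2 h3
    · have := h.2.2.1 l (k + 1) hl1 (by omega) (by omega) (by omega) (f0.trans e1.symm)
      have := h.2.2.1 (l + 1) k (by omega) (by omega) (by omega) (by omega) (f1.trans e0.symm)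
      omega
    · obtain rfl := h.2.2.1 (l + 1) k (by omega) (by omega) (by omega) (by omega)
        (f1.trans e0.symm)
      exact ⟨l, hl1, by omega, Or.inr ⟨f0, e0, e1, e2⟩⟩

end IsOpenMeandricPerm

theorem IsIrreducibleMeander.not_interval {n : ℕ} {a : ℕ → ℕ} (h : IsIrreducibleMeander n a)
    (hn : 5 ≤ n) {k v l m : ℕ} (hk : 1 ≤ k) (hkn : k + 3 ≤ n)
    (hv : ∀ i ∈ Finset.Icc k (k + 3), v ≤ a i ∧ a i ≤ v + 3)
    (hl : l ∈ Finset.Icc k (k + 3)) (hlv : a l = v)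
    (hm : m ∈ Finset.Icc k (k + 3)) (hmv : a m = v + 3) : False := by
  refine h ⟨k, k + 3, by omega, hk, hkn, by omega, by omega, ?_⟩
  have hsup : (Finset.Icc k (k + 3)).sup' (Finset.nonempty_Icc.mpr (by omega)) a = v + 3 :=
    le_antisymm (Finset.sup'_le _ _ fun i hi => (hv i hi).2) (hmv ▸ Finset.le_sup' a hm)
  have hinf : (Finset.Icc k (k + 3)).inf' (Finset.nonempty_Icc.mpr (by omega)) a = v :=
    le_antisymm (hlv ▸ Finset.inf'_le a hl) (Finset.le_inf' _ _ fun i hi => (hv i hi).1)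
  rw [hsup, hinf]
  omega

/-- Four values `x, y, z, t` filling an interval of length four are not traversed consecutively by
an irreducible open meandric permutation. -/
theorem IsIrreducibleMeander.not_chain {n : ℕ} {a : ℕ → ℕ} (hirr : IsIrreducibleMeander n a)
    (h : IsOpenMeandricPerm n a) (hn : 5 ≤ n) {v r s x y z t : ℕ} (hrs : r ≠ s)
    (h1 : ConsecutiveAt n a r x y) (h2 : ConsecutiveAt n a s y z) (h3 : ConsecutiveAt n a r z t)
    (hlo : v ≤ x ∧ v ≤ y ∧ v ≤ z ∧ v ≤ t)
    (hhi : x ≤ v + 3 ∧ y ≤ v + 3 ∧ z ≤ v + 3 ∧ t ≤ v + 3)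
    (hmin : x = v ∨ y = v ∨ z = v ∨ t = v)
    (hmax : x = v + 3 ∨ y = v + 3 ∨ z = v + 3 ∨ t = v + 3) : False := by
  obtain ⟨k, hk, hkn, hcase⟩ := h.exists_chain_four hrs h1 h2 h3
  have hmem : ∀ d ≤ 3, k + d ∈ Finset.Icc k (k + 3) := fun d hd => by
    simp only [Finset.mem_Icc]
    omega
  have hl : ∃ l ∈ Finset.Icc k (k + 3), a l = v := by
    have : a k = v ∨ a (k + 1) = v ∨ a (k + 2) = v ∨ a (k + 3) = v := by omega
    rcases this with e | e | e | e
    · exact ⟨k, hmem 0 (by norm_num), e⟩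
    · exact ⟨k + 1, hmem 1 (by norm_num), e⟩
    · exact ⟨k + 2, hmem 2 (by norm_num), e⟩
    · exact ⟨k + 3, hmem 3 (by norm_num), e⟩
  have hm : ∃ l ∈ Finset.Icc k (k + 3), a l = v + 3 := by
    have : a k = v + 3 ∨ a (k + 1) = v + 3 ∨ a (k + 2) = v + 3 ∨ a (k + 3) = v + 3 := by omega
    rcases this with e | e | e | e
    · exact ⟨k, hmem 0 (by norm_num), e⟩
    · exact ⟨k + 1, hmem 1 (by norm_num), e⟩
    · exact ⟨k + 2, hmem 2 (by norm_num), e⟩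
    · exact ⟨k + 3, hmem 3 (by norm_num), e⟩
  obtain ⟨l, hl, hlv⟩ := hl
  obtain ⟨m, hm, hmv⟩ := hm
  refine hirr.not_interval hn hk hkn ?_ hl hlv hm hmv
  intro i hi
  rw [Finset.mem_Icc] at hi
  have : i = k ∨ i = k + 1 ∨ i = k + 2 ∨ i = k + 3 := by omega
  rcases this with rfl | rfl | rfl | rfl <;> omega

/-- The first components of four consecutive letters, read as brackets, together with the second
components, show four consecutive values forming an interval traversed consecutively. -/
def reducibleWindow (u₀ u₁ u₂ u₃ l₀ l₁ l₂ l₃ : Bool) : Bool :=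
  (u₀ && !u₁ && u₂ && !u₃ && l₁ && !l₂) ||
    (u₀ && u₁ && !u₂ && !u₃ && ((l₀ && !l₁) || (l₂ && !l₃)))

/-- The condition imposed on four consecutive letters; a letter records whether an upper and whether
a lower arc starts at a value. -/
def admissible (a b c d : Bool × Bool) : Bool :=
  !((a.1 && !b.1 && a.2 && !b.2) || reducibleWindow a.1 b.1 c.1 d.1 a.2 b.2 c.2 d.2 ||
    reducibleWindow a.2 b.2 c.2 d.2 a.1 b.1 c.1 d.1)

/-- The words of length `n` that may follow the letters `a, b, c`. -/
def admissibleWords : ℕ → Bool × Bool → Bool × Bool → Bool × Bool → Finset (List (Bool × Bool))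
  | 0, _, _, _ => {[]}
  | n + 1, a, b, c => Finset.univ.biUnion fun d =>
      if admissible a b c d then (admissibleWords n b c d).image (List.cons d) else ∅

/-- The position of a letter in the alphabet. -/
def letterIndex (a : Bool × Bool) : ℕ := 2 * a.1.toNat + a.2.toNat

/-- A positive subinvariant vector, with ratio `3.33`, for the transfer matrix of admissible
words. -/
def windowWeight (a b c : Bool × Bool) : ℕ :=
  [52, 48, 48, 25, 52, 43, 42, 22, 52, 42, 43, 22, 2, 29, 29, 20,
   52, 48, 48, 25, 52, 43, 26, 22, 52, 20, 43, 22, 2, 29, 22, 20,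
   52, 48, 48, 25, 52, 43, 20, 22, 52, 26, 43, 22, 2, 22, 29, 20,
   1, 1, 1, 1, 22, 43, 7, 22, 22, 7, 43, 22, 2, 22, 22, 20].getD
    (16 * letterIndex a + 4 * letterIndex b + letterIndex c) 0

theorem one_le_windowWeight : ∀ a b c, 1 ≤ windowWeight a b c := by decide +kernel

theorem sum_windowWeight_le : ∀ a b c,
    100 * ∑ d, (if admissible a b c d then windowWeight b c d else 0) ≤
      333 * windowWeight a b c := by decide +kernel

theorem card_admissibleWords_le (n : ℕ) : ∀ a b c,
    ((admissibleWords n a b c).card : ℝ) ≤ windowWeight a b c * 3.33 ^ n := by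
  induction n with
  | zero =>
    intro a b c
    simpa [admissibleWords] using one_le_windowWeight a b c
  | succ n ih =>
    intro a b c
    have h1 : (admissibleWords (n + 1) a b c).card ≤
        ∑ d, if admissible a b c d then (admissibleWords n b c d).card else 0 := by
      refine Finset.card_biUnion_le.trans (Finset.sum_le_sum fun d _ => ?_)
      split_ifs
      · exact Finset.card_image_le
      · simp
    have h2 : ((∑ d, if admissible a b c d then (admissibleWords n b c d).card else 0 : ℕ) : ℝ) ≤
        (∑ d, if admissible a b c d then windowWeight b c d else 0 : ℕ) * 3.33 ^ n := by
      push_cast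
      rw [Finset.sum_mul]
      refine Finset.sum_le_sum fun d _ => ?_
      split_ifs
      · exact ih b c d
      · simp
    have h3 : (100 : ℝ) * (∑ d, if admissible a b c d then windowWeight b c d else 0 : ℕ) ≤
        333 * windowWeight a b c := by exact_mod_cast sum_windowWeight_le a b c
    have h4 : ((admissibleWords (n + 1) a b c).card : ℝ) ≤
        (∑ d, if admissible a b c d then (admissibleWords n b c d).card else 0 : ℕ) := by
      exact_mod_cast h1
    calc ((admissibleWords (n + 1) a b c).card : ℝ)
        ≤ (∑ d, if admissible a b c d then windowWeight b c d else 0 : ℕ) * 3.33 ^ n :=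
          h4.trans h2
      _ ≤ (3.33 * windowWeight a b c) * 3.33 ^ n := by
          gcongr
          linarith
      _ = windowWeight a b c * 3.33 ^ (n + 1) := by ring

/-- The word `g 3, …, g (n + 2)`. -/
def wordOf (g : ℕ → Bool × Bool) (n : ℕ) : List (Bool × Bool) :=
  (List.range n).map fun k => g (k + 3)

theorem wordOf_mem (n : ℕ) : ∀ g : ℕ → Bool × Bool,
    (∀ k < n, admissible (g k) (g (k + 1)) (g (k + 2)) (g (k + 3))) →
    wordOf g n ∈ admissibleWords n (g 0) (g 1) (g 2) := by
  induction n with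
  | zero => simp [wordOf, admissibleWords]
  | succ n ih =>
    intro g hg
    have h0 := hg 0 (by omega)
    have h1 := ih (fun k => g (k + 1)) fun k hk => hg (k + 1) (by omega)
    simp only [admissibleWords, Finset.mem_biUnion, Finset.mem_univ, true_and]
    refine ⟨g 3, ?_⟩
    rw [if_pos h0, Finset.mem_image]
    refine ⟨_, h1, ?_⟩
    simp [wordOf, List.range_succ_eq_map]

open Classical in
/-- Whether an upper arc, and whether a lower arc, starts at the value `v`. -/
noncomputable def letterAt (n : ℕ) (a : ℕ → ℕ) (v : ℕ) : Bool × Bool :=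
  (decide (∃ q, SideArc n a 1 v q), decide (∃ q, SideArc n a 0 v q))

theorem letterAt_zero {n : ℕ} {a : ℕ → ℕ} (h : IsOpenMeandricPerm n a) :
    letterAt n a 0 = (false, false) := by
  have key : ∀ r, ¬ ∃ q, SideArc n a r 0 q := by
    rintro r ⟨q, -, i, h1, h2, -, h4⟩
    have b1 := h.2.1 i h1 h2.le
    have b2 := h.2.1 (i + 1) (by omega) (by omega)
    omega
  simp [letterAt, key]

theorem admissible_of_first (b c d : Bool × Bool) : admissible (false, false) b c d = true := by
  revert b c d
  decide

theorem reducibleWindow_eq_false {n : ℕ} {a : ℕ → ℕ} (h : IsOpenMeandricPerm n a)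
    (hirr : IsIrreducibleMeander n a) (hn : 5 ≤ n) {r s : ℕ} (hrs : r ≠ s) (v : ℕ)
    {u₀ u₁ u₂ u₃ l₀ l₁ l₂ l₃ : Bool}
    (hu₀ : u₀ = true ↔ ∃ q, SideArc n a r v q) (hu₁ : u₁ = true ↔ ∃ q, SideArc n a r (v + 1) q)
    (hu₂ : u₂ = true ↔ ∃ q, SideArc n a r (v + 2) q)
    (hu₃ : u₃ = true ↔ ∃ q, SideArc n a r (v + 3) q)
    (hl₀ : l₀ = true ↔ ∃ q, SideArc n a s v q) (hl₁ : l₁ = true ↔ ∃ q, SideArc n a s (v + 1) q)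
    (hl₂ : l₂ = true ↔ ∃ q, SideArc n a s (v + 2) q)
    (hl₃ : l₃ = true ↔ ∃ q, SideArc n a s (v + 3) q) :
    reducibleWindow u₀ u₁ u₂ u₃ l₀ l₁ l₂ l₃ = false := by
  have hU := h.isArcSystem r
  have hL := h.isArcSystem s
  rw [Bool.eq_false_iff]
  intro hw
  simp only [reducibleWindow, Bool.or_eq_true, Bool.and_eq_true, Bool.not_eq_true',
    ← Bool.not_eq_true, hu₀, hu₁, hu₂, hu₃, hl₀, hl₁, hl₂, hl₃] at hw
  rcases hw with ⟨⟨⟨⟨⟨h0, h1⟩, h2⟩, h3⟩, h4⟩, h5⟩ | ⟨⟨⟨⟨h0, h1⟩, h2⟩, h3⟩, ⟨h4, h5⟩ | ⟨h4, h5⟩⟩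
  · exact hirr.not_chain (v := v) h hn hrs (hU.adjacent h0 h1).2
      (hL.adjacent h4 h5).2 (hU.adjacent h2 h3).2 (by omega) (by omega) (by omega) (by omega)
  · exact hirr.not_chain (v := v) h hn hrs (hU.enclosing h0 h1 h2 h3).2.symm
      (hL.adjacent h4 h5).2 (hU.adjacent h1 h2).2 (by omega) (by omega) (by omega) (by omega)
  · exact hirr.not_chain (v := v) h hn hrs (hU.adjacent h1 h2).2
      (hL.adjacent h4 h5).2 (hU.enclosing h0 h1 h2 h3).2.symm (by omega) (by omega) (by omega)
      (by omega)

theorem admissible_letterAt {n : ℕ} {a : ℕ → ℕ} (h : IsOpenMeandricPerm n a)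
    (hirr : IsIrreducibleMeander n a) (hn : 5 ≤ n) (v : ℕ) :
    admissible (letterAt n a v) (letterAt n a (v + 1)) (letterAt n a (v + 2))
      (letterAt n a (v + 3)) = true := by
  have hU : ∀ w, (letterAt n a w).1 = true ↔ ∃ q, SideArc n a 1 w q := by simp [letterAt]
  have hL : ∀ w, (letterAt n a w).2 = true ↔ ∃ q, SideArc n a 0 w q := by simp [letterAt]
  have w1 := reducibleWindow_eq_false h hirr hn one_ne_zero v (hU v) (hU (v + 1)) (hU (v + 2))
    (hU (v + 3)) (hL v) (hL (v + 1)) (hL (v + 2)) (hL (v + 3))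
  have w2 := reducibleWindow_eq_false h hirr hn zero_ne_one v (hL v) (hL (v + 1)) (hL (v + 2))
    (hL (v + 3)) (hU v) (hU (v + 1)) (hU (v + 2)) (hU (v + 3))
  rw [admissible, w1, w2, Bool.or_false, Bool.or_false, Bool.not_eq_true', Bool.eq_false_iff]
  intro hw
  simp only [Bool.and_eq_true, Bool.not_eq_true', ← Bool.not_eq_true, hU, hL] at hw
  obtain ⟨⟨⟨h0, h1⟩, h2⟩, h3⟩ := hw
  exact h.not_joined_both one_ne_zero ((h.isArcSystem 1).adjacent h0 h1).2
    ((h.isArcSystem 0).adjacent h2 h3).2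

/-- The number of irreducible open meandric permutations grows at most like `3.33 ^ n`. -/
theorem irrMeanderCount_le {n : ℕ} (hn : 5 ≤ n) : (irrMeanderCount n : ℝ) ≤ 52 * 3.33 ^ n := by
  set W := admissibleWords n (false, false) (false, false) (false, false) with hW
  have hle : irrMeanderCount n ≤ (W : Set (List (Bool × Bool))).ncard := by
    refine Set.ncard_le_ncard_of_injOn (fun a => wordOf (fun k => letterAt n a (k - 2)) n)
      ?_ ?_ W.finite_toSet
    · rintro a ⟨ha, hirr, -⟩
      have h0 := letterAt_zero ha
      have := wordOf_mem n (fun k => letterAt n a (k - 2)) ?_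
      · simpa [h0] using this
      · intro k _
        rcases (show k = 0 ∨ k = 1 ∨ 2 ≤ k by omega) with rfl | rfl | hk
        · simp only [Nat.zero_sub, h0, admissible_of_first]
        · simp only [show 1 - 2 = 0 from rfl, h0, admissible_of_first]
        · obtain ⟨v, rfl⟩ := Nat.exists_eq_add_of_le' hk
          exact admissible_letterAt ha hirr hn v
    · rintro a ⟨ha, -, ha0⟩ b ⟨hb, -, hb0⟩ hab
      have hlet : ∀ v, letterAt n a v = letterAt n b v := by
        intro v
        rcases Nat.eq_zero_or_pos v with rfl | hv
        · rw [letterAt_zero ha, letterAt_zero hb]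
        rcases Nat.lt_or_ge n v with hnv | hnv
        · have key : ∀ c, IsOpenMeandricPerm n c → ∀ r, ¬ ∃ q, SideArc n c r v q := by
            rintro c hc r ⟨q, -, i, h1, h2, -, h4⟩
            have b1 := hc.2.1 i h1 h2.le
            have b2 := hc.2.1 (i + 1) (by omega) (by omega)
            omega
          simp [letterAt, key a ha, key b hb]
        · have := List.map_inj_left.1 hab (v - 1) (by rw [List.mem_range]; omega)
          dsimp only at this
          rwa [show v - 1 + 3 - 2 = v by omega] at this
      funext i
      by_cases hi : 1 ≤ i ∧ i ≤ n
      · refine ha.eq_of_openers hb ?_ i hi.1 hi.2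
        intro r hr v
        have := hlet v
        simp only [letterAt, Prod.mk.injEq, decide_eq_decide] at this
        interval_cases r
        · exact this.2
        · exact this.1
      · rw [ha0 i (by omega), hb0 i (by omega)]
  rw [Set.ncard_coe_finset] at hle
  calc (irrMeanderCount n : ℝ) ≤ W.card := by exact_mod_cast hle
    _ ≤ (windowWeight (false, false) (false, false) (false, false) : ℕ) * 3.33 ^ n :=
      card_admissibleWords_le n _ _ _
    _ = 52 * 3.33 ^ n := by norm_num [windowWeight, letterIndex]

/-- If `L = lim (M n)^(1/n)` exists and `L ≤ √12.901`, then
`limsup (M^{Irr} n)^(1/n) ≤ 3.33341`. -/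
theorem irr_meander_growth_upper_bound (L : ℝ)
    (hL : Tendsto (fun n : ℕ => (openMeanderCount n : ℝ) ^ (1 / (n : ℝ))) atTop (nhds L))
    (hL' : L ≤ Real.sqrt 12.901) :
    limsup (fun n : ℕ => (irrMeanderCount n : ℝ) ^ (1 / (n : ℝ))) atTop ≤ 3.33341 := by
  have hlim : Tendsto (fun n : ℕ => (52 : ℝ) ^ (1 / (n : ℝ)) * 3.33) atTop (nhds 3.33) := by
    have h := (tendsto_const_nhds (x := (52 : ℝ))).rpow
      (tendsto_one_div_atTop_nhds_zero_nat (𝕜 := ℝ)) (Or.inl (by norm_num))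
    simpa using h.mul_const (3.33 : ℝ)
  have hev := hlim.eventually (eventually_le_nhds (show (3.33 : ℝ) < 3.33341 by norm_num))
  refine limsup_le_of_le
    (isCoboundedUnder_le_of_le atTop (x := 0) fun n => by positivity) ?_
  filter_upwards [hev, eventually_ge_atTop 5] with n hn h5
  refine le_trans ?_ hn
  have hn0 : (n : ℝ) ≠ 0 := by positivity
  calc (irrMeanderCount n : ℝ) ^ (1 / (n : ℝ)) ≤ (52 * 3.33 ^ n) ^ (1 / (n : ℝ)) := by
        gcongr
        exact irrMeanderCount_le h5
    _ = 52 ^ (1 / (n : ℝ)) * 3.33 := by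
        rw [Real.mul_rpow (by norm_num) (by positivity), ← Real.rpow_natCast,
          ← Real.rpow_mul (by norm_num), mul_one_div_cancel hn0, Real.rpow_one]
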